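/- Let φ be a smooth solution of the sine-Gordon equation on ℝ² and let U : ℝ²×(0,∞) → M₂(ℂ) be smooth and satisfy the Lax system in (x,y) for each λ > 0, with U(0,0,λ) = I and U(x,y,λ) ∈ SU(2). Define ψ(x,y,λ) := λ·(∂_λU)·U⁻¹ and N(x,y,λ) := U·((i/2)σ₃)·U⁻¹. Then for all (x,y) and λ > 0: ⟨N,N⟩ = 1, ⟨N, ∂ₓψ⟩ = 0, ⟨N, ∂_yψ⟩ = 0, and ∂_y∂ₓψ = −sin(φ(x,y))·N. In particular the second fundamental form ⟨∂_y∂ₓψ, N⟩ dx dy = −sin φ dx dy is independent of λ, so the deformation λ ↦ ψ(·,·,λ) preserves the second fundamental form. -/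

import Mathlib

open Matrix Complex

attribute [local instance] Matrix.normedAddCommGroup Matrix.normedSpace

noncomputable section

/-- The Pauli matrix σ₃. -/
def sigma3 : Matrix (Fin 2) (Fin 2) ℂ := !![1, 0; 0, -1]

/-- The matrix `A_φ(x,y,λ) = (i/2)·[[∂ₓφ, −λ], [−λ, −∂ₓφ]]` of the Lax system. -/
def Aphi (φ : ℝ → ℝ → ℝ) (lam : ℂ) (x y : ℝ) : Matrix (Fin 2) (Fin 2) ℂ :=
  (Complex.I / 2) •
    !![((deriv (fun x' => φ x' y) x : ℝ) : ℂ), -lam;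
       -lam, -((deriv (fun x' => φ x' y) x : ℝ) : ℂ)]

/-- The matrix `B_φ(x,y,λ) = (i/2)·λ⁻¹·[[0, e^{−iφ}], [e^{iφ}, 0]]` of the Lax system. -/
def Bphi (φ : ℝ → ℝ → ℝ) (lam : ℂ) (x y : ℝ) : Matrix (Fin 2) (Fin 2) ℂ :=
  (Complex.I / 2) • lam⁻¹ •
    !![0, Complex.exp (-Complex.I * ((φ x y : ℝ) : ℂ));
       Complex.exp (Complex.I * ((φ x y : ℝ) : ℂ)), 0]

/-- Membership in SU(2): unitary with determinant one. -/
def IsSU2 (g : Matrix (Fin 2) (Fin 2) ℂ) : Prop := g * gᴴ = 1 ∧ g.det = 1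

/-- The bilinear pairing `⟨X,Y⟩ = −2·tr(X·Y)` on 2×2 complex matrices. -/
def pairing (X Y : Matrix (Fin 2) (Fin 2) ℂ) : ℂ := -2 * (X * Y).trace

/-- The Sym formula: `ψ(x,y,λ) = λ·(∂_λU)·U⁻¹`. -/
def symMap (U : ℝ → ℝ → ℝ → Matrix (Fin 2) (Fin 2) ℂ) (x y lam : ℝ) :
    Matrix (Fin 2) (Fin 2) ℂ :=
  (lam : ℂ) • (deriv (fun l : ℝ => U x y l) lam * (U x y lam)⁻¹)

/-- The extended frame hypotheses: `U` is smooth on `ℝ² × (0,∞)`, solves the Lax system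
of `φ` for each `λ > 0`, satisfies `U(0,0,λ) = I`, and takes values in SU(2). -/
def IsExtendedFrame (φ : ℝ → ℝ → ℝ) (U : ℝ → ℝ → ℝ → Matrix (Fin 2) (Fin 2) ℂ) : Prop :=
  ContDiffOn ℝ (⊤ : ℕ∞) (fun p : ℝ × ℝ × ℝ => U p.1 p.2.1 p.2.2)
    (Set.univ ×ˢ Set.univ ×ˢ Set.Ioi 0) ∧
  (∀ lam : ℝ, 0 < lam → ∀ x y : ℝ,
    HasDerivAt (fun x' => U x' y lam) (U x y lam * Aphi φ (lam : ℂ) x y) x ∧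
    HasDerivAt (fun y' => U x y' lam) (U x y lam * Bphi φ (lam : ℂ) x y) y) ∧
  (∀ lam : ℝ, 0 < lam → U 0 0 lam = 1) ∧
  (∀ x y lam : ℝ, 0 < lam → IsSU2 (U x y lam))

/-- The Gauss map `N = U·((i/2)σ₃)·U⁻¹` of the Sym immersion. -/
def gaussN (U : ℝ → ℝ → ℝ → Matrix (Fin 2) (Fin 2) ℂ) (x y lam : ℝ) :
    Matrix (Fin 2) (Fin 2) ℂ :=
  U x y lam * ((Complex.I / 2) • sigma3) * (U x y lam)⁻¹

/-- Symmetry of mixed partial derivatives: the `s`-derivative of `∂ₜ G` is the `t`-derivative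
of `∂ₛ G`. -/
theorem ContDiffAt.hasDerivAt_deriv_comm {E : Type*} [NormedAddCommGroup E] [NormedSpace ℝ E]
    {G : ℝ → ℝ → E} {a b : ℝ} (hG : ContDiffAt ℝ 2 (fun p : ℝ × ℝ => G p.1 p.2) (a, b))
    {H : ℝ → E} {H' : E} (hH : ∀ᶠ t in nhds b, HasDerivAt (fun s => G s t) (H t) a)
    (hH' : HasDerivAt H H' b) :
    HasDerivAt (fun s => deriv (fun t => G s t) b) H' a := by
  set F : ℝ × ℝ → E := fun p => G p.1 p.2 with hF
  have hs (s t : ℝ) : HasDerivAt (fun s : ℝ => (s, t)) ((1 : ℝ), (0 : ℝ)) s :=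
    (hasDerivAt_id s).prodMk (hasDerivAt_const s t)
  have ht (s t : ℝ) : HasDerivAt (fun t : ℝ => (s, t)) ((0 : ℝ), (1 : ℝ)) t :=
    (hasDerivAt_const t s).prodMk (hasDerivAt_id t)
  have hdiff : ∀ᶠ p in nhds (a, b), DifferentiableAt ℝ F p :=
    (hG.eventually (by simp)).mono fun p hp => hp.differentiableAt (by simp)
  have hF' : HasFDerivAt (fderiv ℝ F) (fderiv ℝ (fderiv ℝ F) (a, b)) (a, b) :=
    ((hG.fderiv_right (m := 1) one_add_one_eq_two.le).differentiableAt one_ne_zero).hasFDerivAt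
  have hsymm : IsSymmSndFDerivAt ℝ F (a, b) := hG.isSymmSndFDerivAt (by simp)
  have h1 : HasDerivAt (fun s => fderiv ℝ F (s, b) (0, 1))
      (fderiv ℝ (fderiv ℝ F) (a, b) (1, 0) (0, 1)) a :=
    (ContinuousLinearMap.apply ℝ E ((0 : ℝ), (1 : ℝ))).hasFDerivAt.comp_hasDerivAt a
      (HasFDerivAt.comp_hasDerivAt (f := fun s => (s, b)) a hF' (hs a b))
  have h2 : HasDerivAt (fun t => fderiv ℝ F (a, t) (1, 0))
      (fderiv ℝ (fderiv ℝ F) (a, b) (0, 1) (1, 0)) b :=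
    (ContinuousLinearMap.apply ℝ E ((1 : ℝ), (0 : ℝ))).hasFDerivAt.comp_hasDerivAt b
      (HasFDerivAt.comp_hasDerivAt (f := fun t => (a, t)) b hF' (ht a b))
  have e1 : (fun s => deriv (fun t => G s t) b) =ᶠ[nhds a]
      fun s => fderiv ℝ F (s, b) (0, 1) := by
    filter_upwards [(hs a b).continuousAt.eventually hdiff] with s hs'
    exact (hs'.hasFDerivAt.comp_hasDerivAt b (ht s b)).deriv
  have e2 : H =ᶠ[nhds b] fun t => fderiv ℝ F (a, t) (1, 0) := by
    filter_upwards [(ht a b).continuousAt.eventually hdiff, hH] with t ht' hHt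
    exact hHt.unique
      (HasFDerivAt.comp_hasDerivAt (f := fun s => (s, t)) a ht'.hasFDerivAt (hs a t))
  have hval : H' = fderiv ℝ (fderiv ℝ F) (a, b) (1, 0) (0, 1) := by
    rw [hsymm.eq]
    exact hH'.unique (h2.congr_of_eventuallyEq e2)
  rw [hval]
  exact h1.congr_of_eventuallyEq e1

/-- A matrix-valued map is differentiable iff its entries are. -/
theorem hasDerivAt_matrix_iff {m n : Type*} [Fintype m] [Fintype n] {V : ℝ → Matrix m n ℂ}
    {V' : Matrix m n ℂ} {a : ℝ} :
    HasDerivAt V V' a ↔ ∀ i j, HasDerivAt (fun s => V s i j) (V' i j) a :=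
  hasDerivAt_pi.trans (forall_congr' fun _ => hasDerivAt_pi)

/-- The product rule for matrix-valued maps. -/
theorem HasDerivAt.mul_matrix {l m n : Type*} [Fintype l] [Fintype m] [Fintype n]
    {V : ℝ → Matrix l m ℂ} {W : ℝ → Matrix m n ℂ}
    {V' : Matrix l m ℂ} {W' : Matrix m n ℂ} {a : ℝ} (hV : HasDerivAt V V' a)
    (hW : HasDerivAt W W' a) :
    HasDerivAt (fun s => V s * W s) (V' * W a + V a * W') a := by
  rw [hasDerivAt_matrix_iff] at *
  intro i j
  simp only [Matrix.mul_apply, Matrix.add_apply, ← Finset.sum_add_distrib]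
  exact HasDerivAt.fun_sum fun k _ => (hV i k).mul (hW k j)

/-- The derivative of the inverse along a solution of `V' = V L` with `det V = 1`, `tr L = 0`. -/
theorem HasDerivAt.inv_matrix_of_det_eq_one {V : ℝ → Matrix (Fin 2) (Fin 2) ℂ}
    {L : Matrix (Fin 2) (Fin 2) ℂ} {a : ℝ} (hV : HasDerivAt V (V a * L) a)
    (hdet : ∀ s, (V s).det = 1) (hL : L.trace = 0) :
    HasDerivAt (fun s => (V s)⁻¹) (-(L * (V a)⁻¹)) a := by
  have hinv (s : ℝ) : (V s)⁻¹ = !![V s 1 1, -V s 0 1; -V s 1 0, V s 0 0] := by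
    rw [Matrix.inv_def, hdet, Matrix.adjugate_fin_two]
    simp
  simp only [hinv]
  rw [hasDerivAt_matrix_iff] at *
  have hL' : L 1 1 = -L 0 0 := by
    rw [Matrix.trace_fin_two] at hL
    linear_combination hL
  have h00 := hV 0 0
  have h01 := hV 0 1
  have h10 := hV 1 0
  have h11 := hV 1 1
  simp only [Matrix.mul_apply, Fin.sum_univ_two, hL'] at h00 h01 h10 h11
  intro i j
  fin_cases i <;> fin_cases j
  · refine h11.congr_deriv ?_
    simp [Matrix.mul_apply, Fin.sum_univ_two]
    ring
  · refine h01.neg.congr_deriv ?_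
    simp [Matrix.mul_apply, Fin.sum_univ_two]
    ring
  · refine h10.neg.congr_deriv ?_
    simp [Matrix.mul_apply, Fin.sum_univ_two, hL']
    ring
  · refine h00.congr_deriv ?_
    simp [Matrix.mul_apply, Fin.sum_univ_two, hL']
    ring

/-- The derivative of `V X V⁻¹` along a solution of `V' = V L` with `det V = 1`, `tr L = 0`. -/
theorem HasDerivAt.conj_matrix {V : ℝ → Matrix (Fin 2) (Fin 2) ℂ}
    {L : Matrix (Fin 2) (Fin 2) ℂ} {a : ℝ} (hV : HasDerivAt V (V a * L) a)
    (hdet : ∀ s, (V s).det = 1) (hL : L.trace = 0) (X : Matrix (Fin 2) (Fin 2) ℂ) :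
    HasDerivAt (fun s => V s * X * (V s)⁻¹) (V a * (L * X - X * L) * (V a)⁻¹) a := by
  refine ((hV.mul_matrix (hasDerivAt_const a X)).mul_matrix
    (hV.inv_matrix_of_det_eq_one hdet hL)).congr_deriv ?_
  noncomm_ring

/-- The derivative of the Sym formula along a solution of `∂ₛ V = V L` is `l • V (∂ₗ L) V⁻¹`. -/
theorem hasDerivAt_sym {V : ℝ → ℝ → Matrix (Fin 2) (Fin 2) ℂ}
    {L : ℝ → Matrix (Fin 2) (Fin 2) ℂ} {L' : Matrix (Fin 2) (Fin 2) ℂ} {a l : ℝ}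
    (hsmooth : ContDiffAt ℝ 2 (fun p : ℝ × ℝ => V p.1 p.2) (a, l))
    (hV : ∀ᶠ m in nhds l, HasDerivAt (fun s => V s m) (V a m * L m) a)
    (hL' : HasDerivAt L L' l) (hdet : ∀ s, (V s l).det = 1) (hL : (L l).trace = 0) :
    HasDerivAt (fun s => (l : ℂ) • (deriv (fun m => V s m) l * (V s l)⁻¹))
      ((l : ℂ) • (V a l * L' * (V a l)⁻¹)) a := by
  obtain ⟨D, hD⟩ : ∃ D, HasDerivAt (fun m => V a m) D l := by
    have hc : DifferentiableAt ℝ (fun m : ℝ => (a, m)) l := by fun_prop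
    exact ⟨_, ((hsmooth.differentiableAt (by simp)).comp l hc).hasDerivAt⟩
  have hDeq : deriv (fun m => V a m) l = D := hD.deriv
  have hmixed : HasDerivAt (fun s => deriv (fun m => V s m) l) (D * L l + V a l * L') a :=
    hsmooth.hasDerivAt_deriv_comm hV (hD.mul_matrix hL')
  have hinv := hV.self_of_nhds.inv_matrix_of_det_eq_one hdet hL
  refine ((hmixed.mul_matrix hinv).const_smul (l : ℂ)).congr_deriv ?_
  rw [hDeq, add_mul, mul_neg, ← mul_assoc, add_right_comm, add_neg_cancel, zero_add]

theorem trace_Aphi (φ : ℝ → ℝ → ℝ) (lam : ℂ) (x y : ℝ) : (Aphi φ lam x y).trace = 0 := by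
  simp [Aphi, Matrix.trace_fin_two]

theorem trace_Bphi (φ : ℝ → ℝ → ℝ) (lam : ℂ) (x y : ℝ) : (Bphi φ lam x y).trace = 0 := by
  simp [Bphi, Matrix.trace_fin_two]

theorem hasDerivAt_Aphi (φ : ℝ → ℝ → ℝ) (x y lam : ℝ) :
    HasDerivAt (fun l : ℝ => Aphi φ (l : ℂ) x y) ((Complex.I / 2) • !![0, -1; -1, 0]) lam := by
  have h : HasDerivAt (fun l : ℝ => Complex.I / 2 * -(l : ℂ)) (Complex.I / 2 * -1) lam :=
    (Complex.ofRealCLM.hasDerivAt (x := lam)).neg.const_mul _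
  rw [hasDerivAt_matrix_iff]
  intro i j
  fin_cases i <;> fin_cases j
  · simpa [Aphi] using hasDerivAt_const lam _
  · simpa [Aphi] using h
  · simpa [Aphi] using h
  · simpa [Aphi] using hasDerivAt_const lam _

theorem hasDerivAt_Bphi (φ : ℝ → ℝ → ℝ) (x y : ℝ) {lam : ℝ} (hlam : lam ≠ 0) :
    HasDerivAt (fun l : ℝ => Bphi φ (l : ℂ) x y) (-(lam : ℂ)⁻¹ • Bphi φ (lam : ℂ) x y) lam := by
  have h : HasDerivAt (fun l : ℝ => (l : ℂ)⁻¹) (-((lam : ℂ) ^ 2)⁻¹) lam :=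
    (hasDerivAt_inv (Complex.ofReal_ne_zero.mpr hlam)).comp_ofReal
  rw [hasDerivAt_matrix_iff]
  intro i j
  refine ((h.mul_const (!![0, Complex.exp (-Complex.I * ((φ x y : ℝ) : ℂ));
    Complex.exp (Complex.I * ((φ x y : ℝ) : ℂ)), 0] i j)).const_mul
      (Complex.I / 2)).congr_deriv ?_
  simp only [Bphi, Matrix.smul_apply, smul_eq_mul]
  ring

theorem pairing_conj {g X Y : Matrix (Fin 2) (Fin 2) ℂ} (hg : g.det = 1) :
    pairing (g * X * g⁻¹) (g * Y * g⁻¹) = pairing X Y := by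
  have hu : IsUnit g.det := by simp [hg]
  have h : g * X * g⁻¹ * (g * Y * g⁻¹) = g * (X * Y) * g⁻¹ := by
    simp only [Matrix.mul_assoc, Matrix.nonsing_inv_mul_cancel_left _ _ hu]
  rw [pairing, pairing, h, Matrix.trace_mul_comm, Matrix.nonsing_inv_mul_cancel_left _ _ hu]

theorem IsExtendedFrame.contDiffAt {φ : ℝ → ℝ → ℝ} {U : ℝ → ℝ → ℝ → Matrix (Fin 2) (Fin 2) ℂ}
    (hU : IsExtendedFrame φ U) (x y : ℝ) {lam : ℝ} (hlam : 0 < lam) :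
    ContDiffAt ℝ 2 (fun p : ℝ × ℝ × ℝ => U p.1 p.2.1 p.2.2) (x, y, lam) := by
  have hopen : IsOpen ((Set.univ : Set ℝ) ×ˢ (Set.univ : Set ℝ) ×ˢ Set.Ioi (0 : ℝ)) :=
    isOpen_univ.prod (isOpen_univ.prod isOpen_Ioi)
  exact (hU.1.contDiffAt (hopen.mem_nhds (by simpa using hlam))).of_le (WithTop.coe_le_coe.mpr le_top)

theorem IsExtendedFrame.hasDerivAt_symMap_x {φ : ℝ → ℝ → ℝ}
    {U : ℝ → ℝ → ℝ → Matrix (Fin 2) (Fin 2) ℂ} (hU : IsExtendedFrame φ U) (x y : ℝ) {lam : ℝ}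
    (hlam : 0 < lam) :
    HasDerivAt (fun x' => symMap U x' y lam) ((lam : ℂ) •
      (U x y lam * ((Complex.I / 2) • !![0, -1; -1, 0]) * (U x y lam)⁻¹)) x := by
  have hc : ContDiffAt ℝ 2 (fun p : ℝ × ℝ => (p.1, y, p.2)) (x, lam) := by fun_prop
  have hsmooth : ContDiffAt ℝ 2 (fun p : ℝ × ℝ => U p.1 y p.2) (x, lam) :=
    ContDiffAt.comp (g := fun p : ℝ × ℝ × ℝ => U p.1 p.2.1 p.2.2) (x, lam)
      (hU.contDiffAt x y hlam) hc
  exact hasDerivAt_sym (V := fun s m => U s y m) hsmooth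
    ((eventually_gt_nhds hlam).mono fun m hm => (hU.2.1 m hm x y).1)
    (hasDerivAt_Aphi φ x y lam) (fun s => (hU.2.2.2 s y lam hlam).2) (trace_Aphi φ _ x y)

theorem IsExtendedFrame.hasDerivAt_symMap_y {φ : ℝ → ℝ → ℝ}
    {U : ℝ → ℝ → ℝ → Matrix (Fin 2) (Fin 2) ℂ} (hU : IsExtendedFrame φ U) (x y : ℝ) {lam : ℝ}
    (hlam : 0 < lam) :
    HasDerivAt (fun y' => symMap U x y' lam) ((lam : ℂ) •
      (U x y lam * (-(lam : ℂ)⁻¹ • Bphi φ (lam : ℂ) x y) * (U x y lam)⁻¹)) y := by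
  have hc : ContDiffAt ℝ 2 (fun p : ℝ × ℝ => (x, p.1, p.2)) (y, lam) := by fun_prop
  have hsmooth : ContDiffAt ℝ 2 (fun p : ℝ × ℝ => U x p.1 p.2) (y, lam) :=
    ContDiffAt.comp (g := fun p : ℝ × ℝ × ℝ => U p.1 p.2.1 p.2.2) (y, lam)
      (hU.contDiffAt x y hlam) hc
  exact hasDerivAt_sym (V := fun s m => U x s m) hsmooth
    ((eventually_gt_nhds hlam).mono fun m hm => (hU.2.1 m hm x y).2)
    (hasDerivAt_Bphi φ x y hlam.ne') (fun s => (hU.2.2.2 x s lam hlam).2) (trace_Bphi φ _ x y)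

theorem pairing_smul_right (c : ℂ) (X Y : Matrix (Fin 2) (Fin 2) ℂ) :
    pairing X (c • Y) = c * pairing X Y := by
  simp only [pairing, Matrix.mul_smul, Matrix.trace_smul, smul_eq_mul]
  ring

/-- The commutator `λ [B, ∂_λ A]` equals `-sin φ · (i/2) σ₃`. -/
theorem commutator_Bphi (φ : ℝ → ℝ → ℝ) (x y : ℝ) {lam : ℂ} (hlam : lam ≠ 0) :
    lam • (Bphi φ lam x y * ((Complex.I / 2) • !![0, -1; -1, 0]) -
        ((Complex.I / 2) • !![0, -1; -1, 0]) * Bphi φ lam x y)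
      = -(((Real.sin (φ x y) : ℝ) : ℂ)) • ((Complex.I / 2) • sigma3) := by
  rw [Complex.ofReal_sin, Complex.sin]
  ext i j
  fin_cases i <;> fin_cases j <;>
    simp [Bphi, sigma3, mul_comm Complex.I (φ x y : ℂ)] <;>
    field_simp <;> ring

/-- `N` is a unit normal of the Sym immersion `ψ` and `∂_y∂ₓψ = −sin(φ)·N`; in particular
the second fundamental form `⟨∂_y∂ₓψ, N⟩ dxdy = −sin φ dxdy` does not depend on `λ`, so the
associated family `λ ↦ ψ(·,·,λ)` preserves the second fundamental form. -/
theorem sym_second_fundamental_form_preserved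
    (φ : ℝ → ℝ → ℝ) (hφ : ContDiff ℝ (⊤ : ℕ∞) (fun p : ℝ × ℝ => φ p.1 p.2))
    (hsg : ∀ x y : ℝ, deriv (fun x' => deriv (fun y' => φ x' y') y) x = Real.sin (φ x y))
    (U : ℝ → ℝ → ℝ → Matrix (Fin 2) (Fin 2) ℂ)
    (hU : IsExtendedFrame φ U) :
    ∀ x y lam : ℝ, 0 < lam →
      pairing (gaussN U x y lam) (gaussN U x y lam) = 1 ∧
      pairing (gaussN U x y lam) (deriv (fun x' => symMap U x' y lam) x) = 0 ∧
      pairing (gaussN U x y lam) (deriv (fun y' => symMap U x y' lam) y) = 0 ∧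
      deriv (fun y' => deriv (fun x' => symMap U x' y' lam) x) y
        = -(((Real.sin (φ x y) : ℝ) : ℂ)) • gaussN U x y lam := by
  intro x y lam hlam
  have hdet : ∀ x y, (U x y lam).det = 1 := fun x y => (hU.2.2.2 x y lam hlam).2
  have hx (y : ℝ) : deriv (fun x' => symMap U x' y lam) x = (lam : ℂ) •
      (U x y lam * ((Complex.I / 2) • !![0, -1; -1, 0]) * (U x y lam)⁻¹) :=
    (hU.hasDerivAt_symMap_x x y hlam).deriv
  have hy : deriv (fun y' => symMap U x y' lam) y = (lam : ℂ) •
      (U x y lam * (-(lam : ℂ)⁻¹ • Bphi φ (lam : ℂ) x y) * (U x y lam)⁻¹) :=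
    (hU.hasDerivAt_symMap_y x y hlam).deriv
  refine ⟨?_, ?_, ?_, ?_⟩
  · rw [gaussN, pairing_conj (hdet x y)]
    simp [pairing, sigma3, Matrix.trace_fin_two]
    linear_combination -Complex.I_sq
  · rw [hx, pairing_smul_right, gaussN, pairing_conj (hdet x y)]
    simp [pairing, sigma3, Matrix.trace_fin_two]
  · rw [hy, pairing_smul_right, gaussN, pairing_conj (hdet x y)]
    simp [pairing, sigma3, Bphi, Matrix.trace_fin_two]
  · have hxy : deriv (fun y' => (lam : ℂ) •
        (U x y' lam * ((Complex.I / 2) • !![0, -1; -1, 0]) * (U x y' lam)⁻¹)) y = _ :=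
      (((hU.2.1 lam hlam x y).2.conj_matrix (fun s => hdet x s) (trace_Bphi φ _ x y)
        ((Complex.I / 2) • !![0, -1; -1, 0])).const_smul (lam : ℂ)).deriv
    rw [funext hx, hxy, gaussN, ← Matrix.smul_mul, ← Matrix.mul_smul,
      commutator_Bphi φ x y (Complex.ofReal_ne_zero.mpr hlam.ne'), Matrix.mul_smul,
      Matrix.smul_mul]

end
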